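/- Let S_1,…,S_m be nonempty subsets of {1,…,n} and let Q = conv( (Δ_{S_1} × {e_1}) ∪ ⋯ ∪ (Δ_{S_m} × {e_m}) ) ⊂ ℝ^{n+m} be the Cayley sum of the unit simplices Δ_{S_1},…,Δ_{S_m}, where e_1,…,e_m are the standard unit vectors of ℝ^m. Then Q has the integer decomposition property: for every positive integer k and every lattice point α ∈ kQ ∩ ℤ^{n+m} there exist α_1,…,α_k ∈ Q ∩ ℤ^{n+m} with α = α_1 + ⋯ + α_k. -/

import Mathlib

open scoped Pointwise

/-- The unit simplex `Δ_S ⊆ ℝ^n`: the convex hull of the standard unit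
vectors `e_i` for `i ∈ S`. -/
noncomputable def unitSimplex (n : ℕ) (S : Finset (Fin n)) : Set (Fin n → ℝ) :=
  convexHull ℝ {x | ∃ i ∈ S, x = Pi.single i 1}

/-- A point of `ℝ^ι` is a lattice point if all its coordinates are integers. -/
def IsLatticePoint {ι : Type*} (x : ι → ℝ) : Prop := ∀ i, ∃ z : ℤ, x i = (z : ℝ)

/-- A set `P ⊆ ℝ^ι` has the integer decomposition property if every lattice
point of the `k`-th dilate `kP` is the sum of `k` lattice points of `P`. -/
def HasIDP {ι : Type*} [Fintype ι] (P : Set (ι → ℝ)) : Prop :=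
  ∀ k : ℕ, 0 < k → ∀ α : ι → ℝ, IsLatticePoint α → α ∈ (k : ℝ) • P →
    ∃ f : Fin k → (ι → ℝ), (∀ j, f j ∈ P ∧ IsLatticePoint (f j)) ∧ (∑ j, f j) = α

/-- The Cayley sum `conv((P_1 × {e_1}) ∪ ⋯ ∪ (P_m × {e_m})) ⊆ ℝ^{n+m}`
of the polytopes `P_1, …, P_m ⊆ ℝ^n`; the ambient space `ℝ^{n+m}` is realized
as `(Fin n ⊕ Fin m) → ℝ`. -/
noncomputable def cayleySum (n m : ℕ) (P : Fin m → Set (Fin n → ℝ)) :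
    Set ((Fin n ⊕ Fin m) → ℝ) :=
  convexHull ℝ (⋃ i : Fin m, (fun x => Sum.elim x (Pi.single i 1)) '' P i)

lemma unitSimplex_props (n : ℕ) (S : Finset (Fin n)) (y : Fin n → ℝ)
    (hy : y ∈ unitSimplex n S) :
    (∀ j, 0 ≤ y j) ∧ (∑ j, y j = 1) ∧ (∀ j, j ∉ S → y j = 0) := by
  have hsub : unitSimplex n S ⊆
      {y | (∀ j, 0 ≤ y j) ∧ (∑ j, y j = 1) ∧ (∀ j, j ∉ S → y j = 0)} := by
    apply convexHull_min
    · rintro x ⟨i, hi, rfl⟩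
      refine ⟨fun j => ?_, by simp, fun j hj => ?_⟩
      · by_cases h : j = i
        · subst h; simp
        · simp [h]
      · have : j ≠ i := fun h => hj (h ▸ hi)
        simp [this]
    · rintro x ⟨hx1, hx2, hx3⟩ y ⟨hy1, hy2, hy3⟩ p q hp hq hpq
      refine ⟨fun j => ?_, ?_, fun j hj => ?_⟩
      · have := hx1 j
        have := hy1 j
        simp only [Pi.add_apply, Pi.smul_apply, smul_eq_mul]
        positivity
      · simp [Finset.sum_add_distrib, ← Finset.mul_sum, hx2, hy2, hpq]
      · simp [hx3 j hj, hy3 j hj]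
  exact hsub hy

lemma cayley_props (n m : ℕ) (S : Fin m → Finset (Fin n)) (x : Fin n ⊕ Fin m → ℝ)
    (hx : x ∈ cayleySum n m (fun i => unitSimplex n (S i))) :
    (∀ j, 0 ≤ x j) ∧ (∑ j, x (Sum.inl j) = 1) ∧ (∑ i, x (Sum.inr i) = 1) ∧
      (∀ J : Finset (Fin n), ∑ j ∈ J, x (Sum.inl j) ≤
        ∑ i with ∃ j ∈ J, j ∈ S i, x (Sum.inr i)) := by
  have hsub : cayleySum n m (fun i => unitSimplex n (S i)) ⊆
      {x | (∀ j, 0 ≤ x j) ∧ (∑ j, x (Sum.inl j) = 1) ∧ (∑ i, x (Sum.inr i) = 1) ∧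
      (∀ J : Finset (Fin n), ∑ j ∈ J, x (Sum.inl j) ≤
        ∑ i with ∃ j ∈ J, j ∈ S i, x (Sum.inr i))} := by
    apply convexHull_min
    · intro x hx
      obtain ⟨i, y, hy, rfl⟩ := Set.mem_iUnion.1 hx
      obtain ⟨h1, h2, h3⟩ := unitSimplex_props _ _ _ hy
      refine ⟨?_, by simpa using h2, by simp, fun J => ?_⟩
      · rintro (j | j)
        · exact h1 j
        · by_cases h : j = i
          · subst h; simp
          · simp [h]
      · simp only [Sum.elim_inl, Sum.elim_inr]
        by_cases h : ∃ j ∈ J, j ∈ S i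
        · have : ∑ i' with ∃ j ∈ J, j ∈ S i', (Pi.single i (1 : ℝ) : Fin m → ℝ) i' = 1 := by
            rw [Finset.sum_pi_single', if_pos (by simpa using h)]
          rw [this, ← h2]
          exact Finset.sum_le_sum_of_subset_of_nonneg (Finset.subset_univ _)
            (fun j _ _ => h1 j)
        · push Not at h
          rw [Finset.sum_eq_zero (fun j hj => h3 j (h j hj))]
          refine Finset.sum_nonneg (fun j _ => ?_)
          by_cases h : j = i
          · subst h; simp
          · simp [h]
    · rintro x ⟨hx1, hx2, hx3, hx4⟩ y ⟨hy1, hy2, hy3, hy4⟩ p q hp hq hpq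
      refine ⟨fun j => ?_, ?_, ?_, fun J => ?_⟩
      · have := hx1 j
        have := hy1 j
        simp only [Pi.add_apply, Pi.smul_apply, smul_eq_mul]
        positivity
      · simp [Finset.sum_add_distrib, ← Finset.mul_sum, hx2, hy2, hpq]
      · simp [Finset.sum_add_distrib, ← Finset.mul_sum, hx3, hy3, hpq]
      · have hx := mul_le_mul_of_nonneg_left (hx4 J) hp
        have hy := mul_le_mul_of_nonneg_left (hy4 J) hq
        simp only [Pi.add_apply, Pi.smul_apply, smul_eq_mul, Finset.sum_add_distrib,
          ← Finset.mul_sum]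
        linarith
  exact hsub hx

lemma sum_sigma_single {N : ℕ} (a : Fin N → ℕ) (j : Fin N) :
    ∑ l : (Σ j, Fin (a j)), (Pi.single l.1 (1 : ℝ) : Fin N → ℝ) j = a j := by
  rw [Fintype.sum_sigma]
  simp [Pi.single_apply]

/-- The integral transportation problem, through Hall's marriage theorem. -/
lemma exists_matching (n m k : ℕ) (S : Fin m → Finset (Fin n)) (a : Fin n → ℕ) (b : Fin m → ℕ)
    (ha : ∑ j, a j = k) (hb : ∑ i, b i = k)
    (h : ∀ J : Finset (Fin n), ∑ j ∈ J, a j ≤ ∑ i with ∃ j ∈ J, j ∈ S i, b i) :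
    ∃ f : (Σ j, Fin (a j)) ≃ (Σ i, Fin (b i)), ∀ l, l.1 ∈ S (f l).1 := by
  classical
  let t : (Σ j, Fin (a j)) → Finset (Σ i, Fin (b i)) := fun l => {r | l.1 ∈ S r.1}
  have hall : ∀ A : Finset (Σ j, Fin (a j)), A.card ≤ (A.biUnion t).card := by
    intro A
    have h1 : A ⊆ (A.image Sigma.fst).sigma (fun _ => Finset.univ) := by
      intro l hl
      simp only [Finset.mem_sigma, Finset.mem_univ, and_true]
      exact Finset.mem_image_of_mem _ hl
    have h2 : (Finset.univ.filter (fun i => ∃ j ∈ A.image Sigma.fst, j ∈ S i)).sigma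
        (fun i => (Finset.univ : Finset (Fin (b i)))) ⊆ A.biUnion t := by
      intro r hr
      simp only [Finset.mem_sigma, Finset.mem_univ, and_true, Finset.mem_filter, true_and,
        Finset.mem_image] at hr
      obtain ⟨j, ⟨l, hl, rfl⟩, hj⟩ := hr
      exact Finset.mem_biUnion.2 ⟨l, hl, by simpa [t] using hj⟩
    have h1' := Finset.card_le_card h1
    have h2' := Finset.card_le_card h2
    rw [Finset.card_sigma] at h1' h2'
    simp only [Finset.card_univ, Fintype.card_fin] at h1' h2'
    exact h1'.trans ((h _).trans h2')
  obtain ⟨f, hf, hft⟩ := (Finset.all_card_le_biUnion_card_iff_exists_injective t).1 hall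
  have hbij : Function.Bijective f :=
    (Fintype.bijective_iff_injective_and_card f).2 ⟨hf, by simp [ha, hb]⟩
  exact ⟨Equiv.ofBijective f hbij, fun l => by simpa [t] using hft l⟩

/-- The Cayley sum of the unit simplices `Δ_{S_1}, …, Δ_{S_m}` has the integer
decomposition property. -/
theorem cayleySum_simplices_hasIDP (n m : ℕ) (S : Fin m → Finset (Fin n))
    (hS : ∀ k, (S k).Nonempty) :
    HasIDP (cayleySum n m (fun i => unitSimplex n (S i))) := by
  intro k hk α hα hmem
  obtain ⟨x, hx, rfl⟩ := hmem
  obtain ⟨h1, h2, h3, h4⟩ := cayley_props n m S x hx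
  have hnat : ∀ i, ∃ c : ℕ, (k : ℝ) * x i = c := by
    intro i
    obtain ⟨z, hz⟩ := hα i
    have hz' : (k : ℝ) * x i = z := hz
    have h0 : (0 : ℝ) ≤ z := hz' ▸ mul_nonneg (Nat.cast_nonneg k) (h1 i)
    lift z to ℕ using (by exact_mod_cast h0)
    exact ⟨z, by simpa using hz'⟩
  choose c hc using hnat
  have ha : ∑ j, c (Sum.inl j) = k := by
    have : ((∑ j, c (Sum.inl j) : ℕ) : ℝ) = k := by
      push_cast
      simp_rw [← hc]
      rw [← Finset.mul_sum, h2, mul_one]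
    exact_mod_cast this
  have hb : ∑ j, c (Sum.inr j) = k := by
    have : ((∑ j, c (Sum.inr j) : ℕ) : ℝ) = k := by
      push_cast
      simp_rw [← hc]
      rw [← Finset.mul_sum, h3, mul_one]
    exact_mod_cast this
  obtain ⟨f, hf⟩ := exists_matching n m k S (fun j => c (Sum.inl j)) (fun i => c (Sum.inr i))
    ha hb (by
      intro J
      have := mul_le_mul_of_nonneg_left (h4 J) (Nat.cast_nonneg (α := ℝ) k)
      rw [Finset.mul_sum, Finset.mul_sum] at this
      simp_rw [hc] at this
      exact_mod_cast this)
  have e : Fin k ≃ (Σ j, Fin (c (Sum.inl j))) :=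
    (Fintype.equivFinOfCardEq (by simp [ha])).symm
  refine ⟨fun t => Sum.elim (Pi.single (e t).1 1) (Pi.single (f (e t)).1 1),
    fun t => ⟨?_, ?_⟩, ?_⟩
  · apply subset_convexHull
    exact Set.mem_iUnion.2 ⟨(f (e t)).1, _, subset_convexHull _ _ ⟨_, hf _, rfl⟩, rfl⟩
  · rintro (j | i)
    · by_cases h : j = (e t).1
      · subst h; exact ⟨1, by simp⟩
      · exact ⟨0, by simp [h]⟩
    · by_cases h : i = (f (e t)).1
      · subst h; exact ⟨1, by simp⟩
      · exact ⟨0, by simp [h]⟩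
  · funext i
    rw [Finset.sum_apply]
    rcases i with j | i
    · simp only [Sum.elim_inl, Pi.smul_apply, smul_eq_mul, hc]
      rw [Equiv.sum_comp e (fun l => (Pi.single l.1 (1 : ℝ) : Fin n → ℝ) j)]
      exact sum_sigma_single (fun j => c (Sum.inl j)) j
    · simp only [Sum.elim_inr, Pi.smul_apply, smul_eq_mul, hc]
      rw [Equiv.sum_comp e (fun l => (Pi.single (f l).1 (1 : ℝ) : Fin m → ℝ) i),
        Equiv.sum_comp f (fun l => (Pi.single l.1 (1 : ℝ) : Fin m → ℝ) i)]
      exact sum_sigma_single (fun i => c (Sum.inr i)) i
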